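/- Define E : L → 𝒫(Γ') on the 16-element set Γ' = {0,1}⁴ of deterministic-state indices by E(f) = { (m,n,l,k) ∈ Γ' : f(ρ_{mnlk}) = 1 }. Then: (i) f(ρ_{mnlk}) ∈ {0,1} for all f ∈ L and all (m,n,l,k); (ii) E is injective on L; (iii) E(1−f) = Γ' \ E(f); (iv) for all f,g ∈ L, f ≤ g pointwise on S if and only if E(f) ⊆ E(g). Hence E is an order isomorphism of the logic L onto a concrete logic of subsets of a 16-point set, so L is set-representable. -/

import Mathlib

namespace BoxWorld

/-- A (2,2)-box assignment: `P a b α β` stands for `P(αβ|ab)`, where the measurement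
settings are `a, b ∈ Fin 2` (with `x = 0`, `y = 1`) and the outcomes are `α, β ∈ Fin 2`. -/
abbrev Box : Type := Fin 2 → Fin 2 → Fin 2 → Fin 2 → ℝ

/-- (P1) positivity, (P2) normalization, (P3) non-signalling. -/
def IsState (P : Box) : Prop :=
  (∀ a b α β, 0 ≤ P a b α β) ∧
  (∀ a b, ∑ α : Fin 2, ∑ β : Fin 2, P a b α β = 1) ∧
  (∀ a b b' α, ∑ β : Fin 2, P a b α β = ∑ β : Fin 2, P a b' α β) ∧
  (∀ a a' b β, ∑ α : Fin 2, P a b α β = ∑ α : Fin 2, P a' b α β)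

/-- The set `S` of (2,2)-box states, as a subtype. -/
abbrev State : Type := {P : Box // IsState P}

/-- The elementary question `e[ab, αβ]`, as a functional on states. -/
def elem (a b α β : Fin 2) : State → ℝ := fun P => P.1 a b α β

abbrev Idx : Type := Fin 2 × Fin 2 × Fin 2 × Fin 2

def elemI (i : Idx) : State → ℝ := elem i.1 i.2.1 i.2.2.1 i.2.2.2

/-- The logic `L` of the (2,2)-box world: all functionals `f = Σ_{e ∈ A} e`, where `A` is a
set of elementary questions whose pointwise sum is `≤ 1` at every state, together with the
complements `1 - f` of all such functionals. -/
def InLogic (f : State → ℝ) : Prop :=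
  (∃ A : Finset Idx, (∀ P : State, ∑ i ∈ A, elemI i P ≤ 1) ∧
      f = fun P => ∑ i ∈ A, elemI i P) ∨
  (∃ A : Finset Idx, (∀ P : State, ∑ i ∈ A, elemI i P ≤ 1) ∧
      f = fun P => 1 - ∑ i ∈ A, elemI i P)

/-- The deterministic state `ρ_{mnlk}`:
`ρ_{mnlk}(αβ|ab) = 1` iff `α ≡ m·a + n (mod 2)` and `β ≡ l·b + k (mod 2)`. -/
def detState (m n l k : Fin 2) : Box := fun a b α β =>
  if α = m * a + n ∧ β = l * b + k then 1 else 0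

lemma sum_snd (c d α : Fin 2) :
    ∑ β : Fin 2, (if α = c ∧ β = d then (1:ℝ) else 0) = if α = c then 1 else 0 := by
  fin_cases d <;> fin_cases c <;> fin_cases α <;> simp [Fin.sum_univ_two]

lemma sum_fst (c d β : Fin 2) :
    ∑ α : Fin 2, (if α = c ∧ β = d then (1:ℝ) else 0) = if β = d then 1 else 0 := by
  fin_cases d <;> fin_cases c <;> fin_cases β <;> simp [Fin.sum_univ_two]

lemma sum_ind (c : Fin 2) : ∑ α : Fin 2, (if α = c then (1:ℝ) else 0) = 1 := by
  fin_cases c <;> simp [Fin.sum_univ_two]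

lemma detState_isState (m n l k : Fin 2) : IsState (detState m n l k) := by
  refine ⟨fun a b α β => ?_, fun a b => ?_, fun a b b' α => ?_, fun a a' b β => ?_⟩
  · unfold detState; split <;> norm_num
  · simp only [detState, sum_snd, sum_ind]
  · simp only [detState, sum_snd]
  · simp only [detState, sum_fst]

/-- `ρ_{mnlk}` as an element of the state space `S`. -/
def detSt (m n l k : Fin 2) : State := ⟨detState m n l k, detState_isState m n l k⟩

/-- `E(f) = {(m,n,l,k) : f(ρ_{mnlk}) = 1}`, the set of deterministic-state indices at
which the question `f` is certain. -/
def E (f : State → ℝ) : Set Idx :=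
  {i : Idx | f (detSt i.1 i.2.1 i.2.2.1 i.2.2.2) = 1}

/-- Two elementary questions are orthogonal if they give contradictory outcomes to a common
measurement on one of the two sides. -/
def Orth (p q : Idx) : Prop :=
  (p.1 = q.1 ∧ p.2.2.1 ≠ q.2.2.1) ∨ (p.2.1 = q.2.1 ∧ p.2.2.2 ≠ q.2.2.2)

/-- The decision tree measuring `a` on the left, then `c α` on the right when the left outcome
is `α`. -/
def leftTree (a : Fin 2) (c : Fin 2 → Fin 2) : Finset Idx :=
  Finset.univ.image fun x : Fin 2 × Fin 2 => (a, c x.1, x.1, x.2)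

/-- The decision tree measuring `b` on the right, then `c β` on the left when the right outcome
is `β`. -/
def rightTree (b : Fin 2) (c : Fin 2 → Fin 2) : Finset Idx :=
  Finset.univ.image fun x : Fin 2 × Fin 2 => (c x.2, b, x.1, x.2)

lemma mem_leftTree {a : Fin 2} {c : Fin 2 → Fin 2} {i : Idx} :
    i ∈ leftTree a c ↔ i.1 = a ∧ i.2.1 = c i.2.2.1 := by
  obtain ⟨a', b', α, β⟩ := i
  simp only [leftTree, Finset.mem_image, Finset.mem_univ, true_and, Prod.exists, Prod.mk.injEq]
  grind

lemma mem_rightTree {b : Fin 2} {c : Fin 2 → Fin 2} {i : Idx} :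
    i ∈ rightTree b c ↔ i.2.1 = b ∧ i.1 = c i.2.2.2 := by
  obtain ⟨a', b', α, β⟩ := i
  simp only [rightTree, Finset.mem_image, Finset.mem_univ, true_and, Prod.exists, Prod.mk.injEq]
  grind

lemma sum_leftTree (a : Fin 2) (c : Fin 2 → Fin 2) (P : State) :
    ∑ i ∈ leftTree a c, elemI i P = 1 := by
  obtain ⟨-, hnorm, hleft, -⟩ := P.2
  rw [leftTree, Finset.sum_image (by rintro ⟨_, _⟩ _ ⟨_, _⟩ _ h; simp_all),
    Fintype.sum_prod_type]
  exact (Finset.sum_congr rfl fun α _ => hleft a (c α) 0 α).trans (hnorm a 0)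

lemma sum_rightTree (b : Fin 2) (c : Fin 2 → Fin 2) (P : State) :
    ∑ i ∈ rightTree b c, elemI i P = 1 := by
  obtain ⟨-, hnorm, -, hright⟩ := P.2
  rw [rightTree, Finset.sum_image (by rintro ⟨_, _⟩ _ ⟨_, _⟩ _ h; simp_all),
    Fintype.sum_prod_type_right]
  exact (Finset.sum_congr rfl fun β _ => hright (c β) 0 b β).trans
    (Finset.sum_comm.trans (hnorm 0 b))

lemma elemI_nonneg (i : Idx) (P : State) : 0 ≤ elemI i P := P.2.1 _ _ _ _

/-- Every set of pairwise orthogonal elementary questions extends to a decomposition of the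
unit. -/
lemma exists_superset_sum_eq_one {A : Finset Idx} (hA : (A : Set Idx).Pairwise Orth) :
    ∃ T, A ⊆ T ∧ ∀ P : State, ∑ i ∈ T, elemI i P = 1 := by
  by_cases hl : ∃ a, ∀ i ∈ A, i.1 = a
  · obtain ⟨a, ha⟩ := hl
    have hc : ∀ α, ∃ b, ∀ i ∈ A, i.2.2.1 = α → i.2.1 = b := by
      intro α
      by_cases h : ∃ j ∈ A, j.2.2.1 = α
      · obtain ⟨j, hj, hjα⟩ := h
        refine ⟨j.2.1, fun i hi hiα => ?_⟩
        by_contra hne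
        have := hA hi hj (by rintro rfl; exact hne rfl)
        simp [Orth] at this
        grind
      · exact ⟨0, fun i hi hiα => absurd ⟨i, hi, hiα⟩ h⟩
    choose c hc using hc
    exact ⟨leftTree a c, fun i hi => mem_leftTree.2 ⟨ha i hi, hc _ i hi rfl⟩, sum_leftTree a c⟩
  · have hr : ∃ b, ∀ i ∈ A, i.2.1 = b := by
      push Not at hl
      obtain ⟨p, hp, -⟩ := hl 0
      obtain ⟨q, hq, hpq⟩ := hl p.1
      refine ⟨p.2.1, fun r hr => ?_⟩
      by_contra hne
      have h₁ := hA hp hq (by rintro rfl; exact hpq rfl)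
      have h₂ := hA hr hp (by rintro rfl; exact hne rfl)
      unfold Orth at h₁ h₂
      have h₃ := hA hr hq (by rintro rfl; grind)
      unfold Orth at h₃
      grind
    obtain ⟨b, hb⟩ := hr
    have hc : ∀ β, ∃ a, ∀ i ∈ A, i.2.2.2 = β → i.1 = a := by
      intro β
      by_cases h : ∃ j ∈ A, j.2.2.2 = β
      · obtain ⟨j, hj, hjβ⟩ := h
        refine ⟨j.1, fun i hi hiβ => ?_⟩
        by_contra hne
        have := hA hi hj (by rintro rfl; exact hne rfl)
        simp [Orth] at this
        grind
      · exact ⟨0, fun i hi hiβ => absurd ⟨i, hi, hiβ⟩ h⟩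
    choose c hc using hc
    exact ⟨rightTree b c, fun i hi => mem_rightTree.2 ⟨hb i hi, hc _ i hi rfl⟩,
      sum_rightTree b c⟩

lemma sum_le_one_of_pairwise {A : Finset Idx} (hA : (A : Set Idx).Pairwise Orth) (P : State) :
    ∑ i ∈ A, elemI i P ≤ 1 := by
  obtain ⟨T, hAT, hT⟩ := exists_superset_sum_eq_one hA
  exact (Finset.sum_le_sum_of_subset_of_nonneg hAT fun i _ _ => elemI_nonneg i P).trans_eq (hT P)

lemma exists_affine : ∀ a α a' α' : Fin 2, (a = a' → α = α') →
    ∃ m n : Fin 2, α = m * a + n ∧ α' = m * a' + n := by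
  decide

/-- Non-orthogonal elementary questions are simultaneously certain at some deterministic
state. -/
lemma exists_detSt_of_not_orth {p q : Idx} (h : ¬ Orth p q) :
    ∃ m n l k, elemI p (detSt m n l k) = 1 ∧ elemI q (detSt m n l k) = 1 := by
  simp only [Orth, not_or, not_and, not_not] at h
  obtain ⟨m, n, h₁, h₂⟩ := exists_affine _ _ _ _ h.1
  obtain ⟨l, k, h₃, h₄⟩ := exists_affine _ _ _ _ h.2
  exact ⟨m, n, l, k, if_pos ⟨h₁, h₃⟩, if_pos ⟨h₂, h₄⟩⟩

lemma pairwise_of_sum_le_one {A : Finset Idx} (hA : ∀ P : State, ∑ i ∈ A, elemI i P ≤ 1) :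
    (A : Set Idx).Pairwise Orth := by
  intro p hp q hq hne
  by_contra h
  obtain ⟨m, n, l, k, h₁, h₂⟩ := exists_detSt_of_not_orth h
  have hsub : ({p, q} : Finset Idx) ⊆ A := by
    intro i hi
    rcases Finset.mem_insert.1 hi with rfl | hi
    · exact hp
    · exact Finset.mem_singleton.1 hi ▸ hq
  have hle := Finset.sum_le_sum_of_subset_of_nonneg hsub
    fun i _ _ => elemI_nonneg i (detSt m n l k)
  rw [Finset.sum_pair hne] at hle
  linarith [hA (detSt m n l k)]

/-- Pairwise orthogonal sums are closed under complement. -/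
lemma exists_compl {A : Finset Idx} (hA : (A : Set Idx).Pairwise Orth) :
    ∃ B : Finset Idx, (B : Set Idx).Pairwise Orth ∧
      ∀ P : State, ∑ i ∈ A, elemI i P = 1 - ∑ i ∈ B, elemI i P := by
  obtain ⟨T, hAT, hT⟩ := exists_superset_sum_eq_one hA
  refine ⟨T \ A, (pairwise_of_sum_le_one fun P => (hT P).le).mono ?_, fun P => ?_⟩
  · exact_mod_cast Finset.sdiff_subset
  · rw [← hT P, ← Finset.sum_sdiff hAT]
    ring

lemma InLogic.exists_sum {f : State → ℝ} (hf : InLogic f) :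
    ∃ A : Finset Idx, (A : Set Idx).Pairwise Orth ∧ ∀ P, f P = ∑ i ∈ A, elemI i P := by
  rcases hf with ⟨A, hA, rfl⟩ | ⟨A, hA, rfl⟩
  · exact ⟨A, pairwise_of_sum_le_one hA, fun _ => rfl⟩
  · obtain ⟨B, hB, hAB⟩ := exists_compl (pairwise_of_sum_le_one hA)
    exact ⟨B, hB, fun P => by simp only [hAB P, sub_sub_cancel]⟩

lemma InLogic.detSt_eq_zero_or_one {f : State → ℝ} (hf : InLogic f) (m n l k : Fin 2) :
    f (detSt m n l k) = 0 ∨ f (detSt m n l k) = 1 := by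
  obtain ⟨A, hA, hfA⟩ := hf.exists_sum
  have hle := sum_le_one_of_pairwise hA (detSt m n l k)
  rw [hfA]
  simp only [elemI, elem, detSt, detState, Finset.sum_boole] at hle ⊢
  norm_cast at hle ⊢
  omega

lemma InLogic.le_of_E_subset {f g : State → ℝ} (hf : InLogic f) (hg : InLogic g)
    (h : E f ⊆ E g) (P : State) : f P ≤ g P := by
  obtain ⟨A, hA, hfA⟩ := hf.exists_sum
  obtain ⟨A', hA', hgA'⟩ := hg.exists_sum
  obtain ⟨B, hB, hgB⟩ := exists_compl hA'
  have hAB : ∀ p ∈ A, ∀ q ∈ B, Orth p q := by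
    intro p hp q hq
    by_contra hpq
    obtain ⟨m, n, l, k, h₁, h₂⟩ := exists_detSt_of_not_orth hpq
    have hfp := Finset.single_le_sum (fun i _ => elemI_nonneg i (detSt m n l k)) hp
    have hgq := Finset.single_le_sum (fun i _ => elemI_nonneg i (detSt m n l k)) hq
    have hf₁ : f (detSt m n l k) = 1 := by
      linarith [hfA (detSt m n l k), sum_le_one_of_pairwise hA (detSt m n l k)]
    have hg₁ : g (detSt m n l k) = 1 := h (show (m, n, l, k) ∈ E f from hf₁)
    linarith [hgA' (detSt m n l k), hgB (detSt m n l k)]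
  have hdisj : Disjoint A B := Finset.disjoint_left.2 fun i hi hi' => by
    simpa [Orth] using hAB i hi i hi'
  have hsymm : ∀ p q, Orth p q → Orth q p := fun p q =>
    Or.imp (And.imp Eq.symm Ne.symm) (And.imp Eq.symm Ne.symm)
  have hunion : ((A ∪ B : Finset Idx) : Set Idx).Pairwise Orth := by
    rw [Finset.coe_union, Set.pairwise_union]
    exact ⟨hA, hB, fun p hp q hq _ => ⟨hAB p hp q hq, hsymm _ _ (hAB p hp q hq)⟩⟩
  have hle := sum_le_one_of_pairwise hunion P
  rw [Finset.sum_union hdisj] at hle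
  linarith [hfA P, hgA' P, hgB P]

/-- (i) every `f ∈ L` takes value `0` or `1` at each deterministic state;
(ii) `E` is injective on `L`; (iii) `E(1 − f) = Γ' \ E(f)`; (iv) `f ≤ g` pointwise on `S`
iff `E(f) ⊆ E(g)`. Hence `E` is an order isomorphism of `L` onto a concrete logic of
subsets of a 16-point set, so `L` is set-representable. -/
theorem set_representation :
    (∀ f : State → ℝ, InLogic f → ∀ m n l k : Fin 2,
      f (detSt m n l k) = 0 ∨ f (detSt m n l k) = 1) ∧
    (∀ f g : State → ℝ, InLogic f → InLogic g → E f = E g → f = g) ∧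
    (∀ f : State → ℝ, InLogic f → E (fun P => 1 - f P) = (E f)ᶜ) ∧
    (∀ f g : State → ℝ, InLogic f → InLogic g →
      ((∀ P : State, f P ≤ g P) ↔ E f ⊆ E g)) := by
  refine ⟨fun f hf => hf.detSt_eq_zero_or_one, fun f g hf hg h => ?_, fun f hf => ?_,
    fun f g hf hg => ⟨fun h i hi => ?_, hf.le_of_E_subset hg⟩⟩
  · exact funext fun P =>
      le_antisymm (hf.le_of_E_subset hg h.le P) (hg.le_of_E_subset hf h.ge P)
  · ext ⟨m, n, l, k⟩
    rcases hf.detSt_eq_zero_or_one m n l k with h | h <;> simp [E, h]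
  · have hi : f (detSt i.1 i.2.1 i.2.2.1 i.2.2.2) = 1 := hi
    have hle := h (detSt i.1 i.2.1 i.2.2.1 i.2.2.2)
    rcases hg.detSt_eq_zero_or_one i.1 i.2.1 i.2.2.1 i.2.2.2 with h₀ | h₁
    · linarith
    · exact h₁

end BoxWorld
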